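/- Let e be a positive integer and S = {x_1,...,x_n} a gcd-closed set of distinct positive integers with max_{x ∈ S} |G_S(x)| ≥ 4. Then there exists an integer matrix M ∈ M_n(ℤ) with [S^e] = M·(S^e) (equivalently, (S^e)^{-1}·[S^e] has integer entries) if and only if S satisfies condition C. -/

import Mathlib

open Finset

/-- `(ξ_e * μ)(d)`: Dirichlet convolution of `n ↦ n^e` with the Möbius function. -/
def xiMu (e d : ℕ) : ℤ :=
  ∑ a ∈ d.divisors, (a : ℤ) ^ e * ArithmeticFunction.moebius (d / a)

/-- `α_{e,S}(x) = Σ_{d ∣ x, d ∤ y for all y ∈ S with y < x} (ξ_e * μ)(d)`. -/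
def alphaES (e : ℕ) (S : Finset ℕ) (x : ℕ) : ℤ :=
  ∑ d ∈ x.divisors.filter (fun d => ∀ y ∈ S, y < x → ¬ d ∣ y), xiMu e d

/-- The set of greatest-type divisors of `x` in `S`. -/
def GS (S : Finset ℕ) (x : ℕ) : Finset ℕ :=
  S.filter (fun y => y ∣ x ∧ y < x ∧ ∀ z ∈ S, y ∣ z → z ∣ x → z = y ∨ z = x)

/-- An element `x` satisfies condition 𝒞 relative to `S`. -/
def condCElem (S : Finset ℕ) (x : ℕ) : Prop :=
  ∀ y ∈ GS S x, ∀ z ∈ GS S x, y ≠ z → Nat.lcm y z = x ∧ Nat.gcd y z ∈ GS S y ∩ GS S z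

/-- A set satisfies condition 𝒞 if every element with at least two
greatest-type divisors satisfies condition 𝒞. -/
def condCSet (S : Finset ℕ) : Prop :=
  ∀ x ∈ S, 2 ≤ (GS S x).card → condCElem S x

/-- `A_S(a,b) = {u ∈ S : a ∣ u ∣ b, u ≠ a}`. -/
def AS (S : Finset ℕ) (a b : ℕ) : Finset ℕ :=
  S.filter (fun u => a ∣ u ∧ u ∣ b ∧ u ≠ a)

/-- `c_{rm}` (with `xr, xm` the actual elements): sum of `μ(d)` over `d` with
`d·xr ∣ xm` and `d·xr ∤ t` for all `t ∈ S` with `t < xm`. -/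
def cCoef (S : Finset ℕ) (xr xm : ℕ) : ℤ :=
  ∑ d ∈ xm.divisors.filter (fun d => d * xr ∣ xm ∧ ∀ t ∈ S, t < xm → ¬ d * xr ∣ t),
    ArithmeticFunction.moebius d

/-- `g(k,m)` (with `xk, xm` the actual elements). -/
noncomputable def gFun (e : ℕ) (S : Finset ℕ) (xk xm : ℕ) : ℚ :=
  (1 / (alphaES e S xm : ℚ)) *
    ∑ r ∈ S.filter (fun r => r ∣ xm), (cCoef S r xm : ℚ) * (Nat.lcm xk r : ℚ) ^ e

section

variable {S : Finset ℕ} {e : ℕ}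

lemma lcm_dvd_lcm_of_dvd {a b c d : ℕ} (hab : a ∣ b) (hcd : c ∣ d) : a.lcm c ∣ b.lcm d :=
  lcm_dvd_lcm hab hcd

lemma dvd_lcm_gcd {n k a b : ℕ} (ha : n ∣ k.lcm a) (hb : n ∣ k.lcm b) :
    n ∣ k.lcm (a.gcd b) := by
  rcases eq_or_ne k 0 with rfl | hk
  · simp
  rcases eq_or_ne a 0 with rfl | ha0
  · simpa using hb
  rcases eq_or_ne b 0 with rfl | hb0
  · simpa using ha
  have hg : a.gcd b ≠ 0 := Nat.gcd_ne_zero_left ha0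
  refine (Nat.dvd_gcd ha hb).trans ?_
  rw [← Nat.factorization_le_iff_dvd (Nat.gcd_ne_zero_left (Nat.lcm_ne_zero hk ha0))
      (Nat.lcm_ne_zero hk hg),
    Nat.factorization_gcd (Nat.lcm_ne_zero hk ha0) (Nat.lcm_ne_zero hk hb0),
    Nat.factorization_lcm hk ha0, Nat.factorization_lcm hk hb0, Nat.factorization_lcm hk hg,
    Nat.factorization_gcd ha0 hb0]
  intro p
  simp only [Finsupp.inf_apply, Finsupp.sup_apply]
  exact (sup_inf_left _ _ _).ge

lemma dvd_lcm_finset_gcd {n k : ℕ} {J : Finset ℕ} (h : ∀ j ∈ J, n ∣ k.lcm j) :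
    n ∣ k.lcm (J.gcd id) := by
  induction J using Finset.induction_on with
  | empty => simp
  | insert a J _ ih =>
    rw [Finset.gcd_insert]
    exact dvd_lcm_gcd (h a (by simp)) (ih fun j hj => h j (by simp [hj]))

/-- Jordan's totient, characterised by its divisor sums, is positive. -/
lemma exists_pos_sum_divisors_eq_pow (he : 0 < e) :
    ∃ J : ℕ → ℕ, (∀ n, 0 < n → ∑ d ∈ n.divisors, J d = n ^ e) ∧ ∀ d, 0 < d → 0 < J d := by
  induction e, he using Nat.le_induction with
  | base =>
    exact ⟨Nat.totient, fun n _ => by simpa using Nat.sum_totient n,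
      fun d hd => Nat.totient_pos.2 hd⟩
  | succ e _ ih =>
    obtain ⟨J, hJ, hpos⟩ := ih
    refine ⟨fun d => ∑ p ∈ (d.divisors ×ˢ d.divisors).filter (fun p => p.1.lcm p.2 = d),
      J p.1 * p.2.totient, fun n hn => ?_, fun d hd => ?_⟩
    · have key : n ^ (e + 1) =
          ∑ p ∈ n.divisors ×ˢ n.divisors, J p.1 * p.2.totient := by
        rw [Finset.sum_product, ← Finset.sum_mul_sum, hJ n hn, Nat.sum_totient, pow_succ]
      rw [key, ← Finset.sum_fiberwise_of_maps_to (t := n.divisors)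
        (g := fun p : ℕ × ℕ => p.1.lcm p.2)]
      · refine Finset.sum_congr rfl fun d hd => Finset.sum_congr ?_ fun _ _ => rfl
        have hdn := Nat.dvd_of_mem_divisors hd
        ext ⟨a, b⟩
        simp only [Finset.mem_filter, Finset.mem_product, Nat.mem_divisors]
        constructor
        · rintro ⟨⟨⟨h1, _⟩, h2, _⟩, h⟩
          exact ⟨⟨⟨h1.trans hdn, hn.ne'⟩, h2.trans hdn, hn.ne'⟩, h⟩
        · rintro ⟨_, h⟩
          have hd0 : d ≠ 0 := (Nat.pos_of_mem_divisors hd).ne'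
          exact ⟨⟨⟨h ▸ Nat.dvd_lcm_left a b, hd0⟩, h ▸ Nat.dvd_lcm_right a b, hd0⟩, h⟩
      · rintro ⟨a, b⟩ h
        simp only [Finset.mem_product, Nat.mem_divisors] at h
        exact Nat.mem_divisors.2 ⟨Nat.lcm_dvd h.1.1 h.2.1, hn.ne'⟩
    · refine Finset.sum_pos' (fun _ _ => Nat.zero_le _) ⟨(d, d), ?_, ?_⟩
      · simp [hd.ne']
      · exact Nat.mul_pos (hpos d hd) (Nat.totient_pos.2 hd)

/-- A set of positive integers closed under `gcd`. -/
def IsGcdClosed (S : Finset ℕ) : Prop :=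
  (∀ a ∈ S, 0 < a) ∧ ∀ a ∈ S, ∀ b ∈ S, a.gcd b ∈ S

lemma IsGcdClosed.gcd_finset_gcd_mem (hS : IsGcdClosed S) {a : ℕ} {J : Finset ℕ} (ha : a ∈ S)
    (hJ : J ⊆ S) : a.gcd (J.gcd id) ∈ S := by
  induction J using Finset.induction_on with
  | empty => simpa using ha
  | insert b J _ ih =>
    rw [Finset.gcd_insert]
    have := hS.2 _ (hJ (Finset.mem_insert_self b J)) _
      (ih ((Finset.subset_insert _ _).trans hJ))
    convert this using 1
    exact Nat.gcd_left_comm a b _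

lemma mem_GS {x y : ℕ} : y ∈ GS S x ↔
    y ∈ S ∧ y ∣ x ∧ y < x ∧ ∀ z ∈ S, y ∣ z → z ∣ x → z = y ∨ z = x := by
  simp [GS]

lemma eq_of_dvd_of_mem_GS {x y z : ℕ} (hy : y ∈ GS S x) (hz : z ∈ GS S x) (h : y ∣ z) :
    y = z := by
  obtain ⟨hzS, hzx, hlt, _⟩ := mem_GS.1 hz
  rcases (mem_GS.1 hy).2.2.2 z hzS h hzx with h | h
  · exact h.symm
  · omega

lemma exists_mem_GS_of_dvd {x g : ℕ} (hx : 0 < x) (hg : g ∈ S) (hgx : g ∣ x) (hne : g ≠ x) :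
    ∃ y ∈ GS S x, g ∣ y := by
  obtain ⟨y, hy, hmax⟩ := Finset.exists_max_image
    (S.filter fun z => g ∣ z ∧ z ∣ x ∧ z ≠ x) id ⟨g, by simp [hg, hgx, hne]⟩
  simp only [Finset.mem_filter, id] at hy hmax
  obtain ⟨hyS, hgy, hyx, hyne⟩ := hy
  refine ⟨y, mem_GS.2 ⟨hyS, hyx, lt_of_le_of_ne (Nat.le_of_dvd hx hyx) hyne,
    fun z hz hyz hzx => ?_⟩, hgy⟩
  by_contra! h
  have hle := hmax z ⟨hz, hgy.trans hyz, hzx, h.2⟩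
  exact h.1 (le_antisymm hle (Nat.le_of_dvd (Nat.pos_of_dvd_of_pos hzx hx) hyz))

/-- Each divisor of `x` in `S` either complements a greatest-type divisor of `x`
or divides all of them. -/
def GSDichotomy (S : Finset ℕ) (x : ℕ) : Prop :=
  ∀ g ∈ S, g ∣ x → (∃ y ∈ GS S x, g.lcm y = x) ∨ ∀ y ∈ GS S x, g ∣ y

lemma lcm_eq_of_condCSet (hS : IsGcdClosed S) (hC : condCSet S) :
    ∀ x ∈ S, ∀ y ∈ GS S x, ∀ g ∈ S, g ∣ x → ¬ g ∣ y → g.lcm y = x := by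
  intro x
  induction x using Nat.strong_induction_on with
  | _ x ih =>
    intro hx y hy g hg hgx hgy
    obtain ⟨-, hyx, -, -⟩ := mem_GS.1 hy
    rcases eq_or_ne g x with rfl | hne
    · exact Nat.lcm_eq_left hyx
    obtain ⟨z, hz, hgz⟩ := exists_mem_GS_of_dvd (hS.1 x hx) hg hgx hne
    have hzy : z ≠ y := fun h => hgy (h ▸ hgz)
    obtain ⟨hlcm, hmem⟩ := hC x hx (Finset.one_lt_card.2 ⟨z, hz, y, hy, hzy⟩) z hz y hy hzy
    obtain ⟨hzS, -, hzx, -⟩ := mem_GS.1 hz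
    have := ih z hzx hzS _ (Finset.mem_inter.1 hmem).1 g hg hgz
      fun h => hgy (h.trans (Nat.gcd_dvd_right _ _))
    rw [← this, Nat.lcm_assoc, Nat.lcm_eq_right (Nat.gcd_dvd_right z y)] at hlcm
    exact hlcm

lemma GSDichotomy.lcm_eq (hS : IsGcdClosed S) {x y z : ℕ} (h : GSDichotomy S x)
    (hy : y ∈ GS S x) (hz : z ∈ GS S x) (hyz : y ≠ z) : y.lcm z = x := by
  by_contra hne
  obtain ⟨hyS, hyx, hy_lt, -⟩ := mem_GS.1 hy
  obtain ⟨hzS, hzx, hz_lt, -⟩ := mem_GS.1 hz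
  set J := (GS S x).filter fun j => y.lcm j = x ∧ z.lcm j = x with hJ
  have hJS : J ⊆ S := fun j hj => (mem_GS.1 (Finset.mem_filter.1 hj).1).1
  have hGS {k : ℕ} (hk : k ∈ GS S x) : k ∣ x := (mem_GS.1 hk).2.1
  have lcm_of_dvd {a b k : ℕ} (hab : a ∣ b) (hb : b ∣ x) (hk : k ∈ GS S x)
      (hak : a.lcm k = x) : b.lcm k = x :=
    Nat.dvd_antisymm (Nat.lcm_dvd hb (hGS hk)) (hak ▸ lcm_dvd_lcm_of_dvd hab dvd_rfl)
  set h₁ := y.gcd (J.gcd id) with hh₁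
  have hh₁S : h₁ ∈ S := hS.gcd_finset_gcd_mem hyS hJS
  set g := z.gcd h₁ with hg
  have hgz : g ∣ z := Nat.gcd_dvd_left _ _
  have hgh : g ∣ h₁ := Nat.gcd_dvd_right _ _
  have hhy : h₁ ∣ y := Nat.gcd_dvd_left _ _
  have hhJ {j : ℕ} (hj : j ∈ J) : h₁ ∣ j := (Nat.gcd_dvd_right _ _).trans (Finset.gcd_dvd hj)
  have hall : ∀ k ∈ GS S x, g ∣ k := by
    rcases h g (hS.2 _ hzS _ hh₁S) (hgz.trans hzx) with ⟨k, hk, hgk⟩ | h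
    · have hkJ : k ∈ J := Finset.mem_filter.2
        ⟨hk, lcm_of_dvd (hgh.trans hhy) hyx hk hgk, lcm_of_dvd hgz hzx hk hgk⟩
      rw [Nat.lcm_eq_right (hgh.trans (hhJ hkJ))] at hgk
      exact absurd hgk (mem_GS.1 hk).2.2.1.ne
    · exact h
  rcases h h₁ hh₁S (hhy.trans hyx) with ⟨k, hk, hhk⟩ | hdvd
  · have hzk : z ∣ k.lcm g := dvd_lcm_gcd (Nat.dvd_lcm_right _ _)
      (by rw [Nat.lcm_comm, hhk]; exact hzx)
    rw [Nat.lcm_eq_left (hall k hk)] at hzk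
    obtain rfl := eq_of_dvd_of_mem_GS hz hk hzk
    exact hne (lcm_of_dvd hhy hyx hz hhk)
  · have hyz' : y ∣ z.lcm h₁ := dvd_lcm_gcd (Nat.dvd_lcm_right _ _)
      (dvd_lcm_finset_gcd fun j hj => by rw [(Finset.mem_filter.1 hj).2.2]; exact hyx)
    rw [Nat.lcm_eq_left (hdvd z hz)] at hyz'
    exact hyz (eq_of_dvd_of_mem_GS hy hz hyz')

lemma GSDichotomy.gcd_mem_GS (hS : IsGcdClosed S) {x y z : ℕ} (h : GSDichotomy S x)
    (hy : y ∈ GS S x) (hz : z ∈ GS S x) (hyz : y ≠ z) : y.gcd z ∈ GS S y := by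
  obtain ⟨hyS, hyx, hy_lt, -⟩ := mem_GS.1 hy
  obtain ⟨hzS, hzx, hz_lt, -⟩ := mem_GS.1 hz
  refine mem_GS.2 ⟨hS.2 _ hyS _ hzS, Nat.gcd_dvd_left _ _, ?_, fun u hu hwu huy => ?_⟩
  · refine lt_of_le_of_ne (Nat.gcd_le_left _ (hS.1 y hyS)) fun heq => hyz ?_
    exact eq_of_dvd_of_mem_GS hy hz (Nat.gcd_eq_left_iff_dvd.1 heq)
  set R := ((GS S x).erase y).erase z with hR
  have hRS : R ⊆ S := fun j hj =>
    (mem_GS.1 (Finset.mem_of_mem_erase (Finset.mem_of_mem_erase hj))).1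
  have hgu : u.gcd (R.gcd id) ∣ u := Nat.gcd_dvd_left _ _
  rcases h _ (hS.gcd_finset_gcd_mem hu hRS) ((hgu.trans huy).trans hyx) with
    ⟨k, hk, hgk⟩ | hdvd
  · have hgk' : ¬ u.gcd (R.gcd id) ∣ k := fun hdvd => by
      rw [Nat.lcm_eq_right hdvd] at hgk
      exact (mem_GS.1 hk).2.2.1.ne hgk
    by_cases hky : k = y
    · exact absurd (hky ▸ hgu.trans huy) hgk'
    by_cases hkz : k = z
    · subst hkz
      have hyu : y ∣ u.lcm (y.gcd k) := dvd_lcm_gcd (Nat.dvd_lcm_right _ _)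
        (hyx.trans (hgk ▸ lcm_dvd_lcm_of_dvd hgu dvd_rfl))
      rw [Nat.lcm_eq_left hwu] at hyu
      exact .inr (Nat.dvd_antisymm huy hyu)
    · have hkR : k ∈ R := by simp [hR, hk, hky, hkz]
      exact absurd ((Nat.gcd_dvd_right _ _).trans (Finset.gcd_dvd hkR)) hgk'
  · have huz : u ∣ z.lcm (u.gcd (R.gcd id)) := dvd_lcm_gcd (Nat.dvd_lcm_right _ _)
      (dvd_lcm_finset_gcd fun j hj => by
        have hj' := Finset.mem_erase.1 hj
        rw [h.lcm_eq hS hz (Finset.mem_of_mem_erase hj'.2) hj'.1.symm]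
        exact huy.trans hyx)
    rw [Nat.lcm_eq_left (hdvd z hz)] at huz
    exact .inl (Nat.dvd_antisymm (Nat.dvd_gcd huy huz) hwu)

lemma condCSet_iff_forall_GSDichotomy (hS : IsGcdClosed S) :
    condCSet S ↔ ∀ x ∈ S, GSDichotomy S x := by
  constructor
  · intro hC x hx g hg hgx
    by_cases hall : ∀ y ∈ GS S x, g ∣ y
    · exact .inr hall
    · push Not at hall
      obtain ⟨y, hy, hgy⟩ := hall
      exact .inl ⟨y, hy, lcm_eq_of_condCSet hS hC x hx y hy g hg hgx hgy⟩
  · intro h x hx _ y hy z hz hyz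
    refine ⟨(h x hx).lcm_eq hS hy hz hyz, Finset.mem_inter.2
      ⟨(h x hx).gcd_mem_GS hS hy hz hyz, ?_⟩⟩
    rw [Nat.gcd_comm]
    exact (h x hx).gcd_mem_GS hS hz hy hyz.symm

/-- The divisors of `lcm k m` dividing `lcm k s` for no smaller `s ∈ S`. -/
def newDivisors (S : Finset ℕ) (k m : ℕ) : Finset ℕ :=
  (k.lcm m).divisors.filter fun n => ∀ s ∈ S, s < m → ¬ n ∣ k.lcm s

lemma mem_newDivisors {k m n : ℕ} : n ∈ newDivisors S k m ↔
    (n ∣ k.lcm m ∧ k.lcm m ≠ 0) ∧ ∀ s ∈ S, s < m → ¬ n ∣ k.lcm s := by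
  simp only [newDivisors, Finset.mem_filter, Nat.mem_divisors]

lemma sum_newDivisors {A : Type*} [AddCommMonoid A] (J : ℕ → A) (hS : IsGcdClosed S) {k r : ℕ}
    (hk : 0 < k) (hr : r ∈ S) :
    ∑ m ∈ S.filter (· ∣ r), ∑ d ∈ newDivisors S k m, J d = ∑ d ∈ (k.lcm r).divisors, J d := by
  rw [← Finset.sum_biUnion]
  · refine Finset.sum_congr ?_ fun _ _ => rfl
    ext n
    simp only [Finset.mem_biUnion, Finset.mem_filter, mem_newDivisors, Nat.mem_divisors]
    constructor
    · rintro ⟨m, ⟨-, hmr⟩, ⟨hn, -⟩, -⟩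
      exact ⟨hn.trans (lcm_dvd_lcm_of_dvd dvd_rfl hmr), Nat.lcm_ne_zero hk.ne' (hS.1 r hr).ne'⟩
    · rintro ⟨hn, -⟩
      obtain ⟨m, hm, hmin⟩ := Finset.exists_min_image (S.filter fun s => n ∣ k.lcm s) id
        ⟨r, by simp [hr, hn]⟩
      simp only [Finset.mem_filter, id] at hm hmin
      have hle := hmin _ ⟨hS.2 m hm.1 r hr, dvd_lcm_gcd hm.2 hn⟩
      have heq := le_antisymm (Nat.gcd_le_left r (hS.1 m hm.1)) hle
      exact ⟨m, ⟨hm.1, Nat.gcd_eq_left_iff_dvd.1 heq⟩,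
        ⟨hm.2, Nat.lcm_ne_zero hk.ne' (hS.1 m hm.1).ne'⟩,
        fun s hs hsm hns => absurd (hmin s ⟨hs, hns⟩) (by omega)⟩
  · intro a ha b hb hab
    rw [Function.onFun, Finset.disjoint_left]
    intro n hna hnb
    simp only [Finset.coe_filter, Set.mem_ofPred_eq] at ha hb
    rw [mem_newDivisors] at hna hnb
    rcases lt_or_gt_of_ne hab with h | h
    · exact hnb.2 a ha.1 h hna.1.1
    · exact hna.2 b hb.1 h hnb.1.1

lemma eq_of_sum_filter_dvd_eq {A : Type*} [AddCommGroup A] {f f' : ℕ → A} {x : ℕ}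
    (h : ∀ r ∈ S, r ∣ x → ∑ m ∈ S.filter (· ∣ r), f m = ∑ m ∈ S.filter (· ∣ r), f' m)
    (hpos : ∀ a ∈ S, 0 < a) : ∀ r ∈ S, r ∣ x → f r = f' r := by
  intro r
  induction r using Nat.strong_induction_on with
  | _ r ih =>
    intro hr hrx
    have hmem : r ∈ S.filter (· ∣ r) := by simp [hr]
    have key := h r hr hrx
    rw [← Finset.add_sum_erase _ _ hmem, ← Finset.add_sum_erase _ _ hmem,
      Finset.sum_congr rfl fun m hm => ?_] at key
    · exact add_right_cancel key
    · simp only [Finset.mem_erase, Finset.mem_filter] at hm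
      exact ih m (lt_of_le_of_ne (Nat.le_of_dvd (hpos r hr) hm.2.2) hm.1) hm.2.1
        (hm.2.2.trans hrx)

lemma newDivisors_subset_of_dvd {g x : ℕ} (hgx : g ∣ x) :
    newDivisors S g x ⊆ newDivisors S 1 x := by
  intro n hn
  rw [mem_newDivisors] at hn ⊢
  rw [Nat.lcm_eq_right hgx] at hn
  simp only [Nat.lcm_one_left]
  exact ⟨hn.1, fun s hs hsx h => hn.2 s hs hsx (h.trans (Nat.dvd_lcm_right _ _))⟩

lemma newDivisors_eq_of_forall_dvd (hS : IsGcdClosed S) {g x : ℕ} (hx : x ∈ S) (hgx : g ∣ x)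
    (h : ∀ y ∈ GS S x, g ∣ y) : newDivisors S g x = newDivisors S 1 x := by
  refine (newDivisors_subset_of_dvd hgx).antisymm fun n hn => ?_
  rw [mem_newDivisors] at hn ⊢
  simp only [Nat.lcm_one_left] at hn
  rw [Nat.lcm_eq_right hgx]
  refine ⟨hn.1, fun s hs hsx hns => ?_⟩
  have hlt : s.gcd x < x := (Nat.gcd_le_left x (hS.1 s hs)).trans_lt hsx
  obtain ⟨y, hy, hsy⟩ := exists_mem_GS_of_dvd (hS.1 x hx) (hS.2 s hs x hx)
    (Nat.gcd_dvd_right s x) hlt.ne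
  obtain ⟨hyS, -, hyx, -⟩ := mem_GS.1 hy
  refine hn.2 y hyS hyx ((dvd_lcm_gcd hns ?_).trans (Nat.lcm_dvd (h y hy) hsy))
  exact hn.1.1.trans (Nat.dvd_lcm_right _ _)

lemma newDivisors_eq_empty {k x y : ℕ} (hy : y ∈ GS S x) (h : (k.gcd x).lcm y = x) :
    newDivisors S k x = ∅ := by
  refine Finset.eq_empty_of_forall_notMem fun n hn => ?_
  rw [mem_newDivisors] at hn
  obtain ⟨hyS, -, hyx, -⟩ := mem_GS.1 hy
  exact hn.2 y hyS hyx (hn.1.1.trans (Nat.lcm_dvd (Nat.dvd_lcm_left _ _)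
    (h.symm.dvd.trans (lcm_dvd_lcm_of_dvd (Nat.gcd_dvd_left _ _) dvd_rfl))))

/-- The coefficient of `m` in the expansion of `lcm k · ^ e` over divisors in `S`. -/
def newSum (S : Finset ℕ) (J : ℕ → ℕ) (k m : ℕ) : ℤ :=
  ∑ d ∈ newDivisors S k m, (J d : ℤ)

lemma sum_newSum {J : ℕ → ℕ} (hJ : ∀ n, 0 < n → ∑ d ∈ n.divisors, J d = n ^ e)
    (hS : IsGcdClosed S) {k r : ℕ} (hk : 0 < k) (hr : r ∈ S) :
    ∑ m ∈ S.filter (· ∣ r), newSum S J k m = (k.lcm r : ℤ) ^ e := by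
  simp only [newSum]
  rw [sum_newDivisors (fun d => (J d : ℤ)) hS hk hr]
  exact_mod_cast hJ _ (Nat.lcm_pos hk (hS.1 r hr))

lemma newSum_eq_pow_mul {J : ℕ → ℕ} (hJ : ∀ n, 0 < n → ∑ d ∈ n.divisors, J d = n ^ e)
    (hS : IsGcdClosed S) {k x : ℕ} (hk : 0 < k) (hx : x ∈ S) :
    newSum S J k x = ((k / k.gcd x : ℕ) : ℤ) ^ e * newSum S J (k.gcd x) x := by
  have hg : 0 < k.gcd x := Nat.gcd_pos_of_pos_left _ hk
  refine eq_of_sum_filter_dvd_eq (x := x)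
    (f' := fun m => ((k / k.gcd x : ℕ) : ℤ) ^ e * newSum S J (k.gcd x) m)
    (fun r hr hrx => ?_) hS.1 x hx dvd_rfl
  rw [← Finset.mul_sum, sum_newSum hJ hS hk hr, sum_newSum hJ hS hg hr, ← mul_pow]
  congr 1
  norm_cast
  have hgr : (k.gcd x).gcd r = k.gcd r := by
    rw [Nat.gcd_assoc, Nat.gcd_eq_right hrx]
  rw [Nat.lcm, Nat.lcm, hgr, ← Nat.mul_div_assoc _
    (hgr ▸ (Nat.gcd_dvd_left (k.gcd x) r).trans (Nat.dvd_mul_right _ _)), ← mul_assoc,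
    Nat.div_mul_cancel (Nat.gcd_dvd_left k x)]

lemma GSDichotomy_iff_newSum_dvd {J : ℕ → ℕ}
    (hJ : ∀ n, 0 < n → ∑ d ∈ n.divisors, J d = n ^ e) (hpos : ∀ d, 0 < d → 0 < J d)
    (hS : IsGcdClosed S) {x : ℕ} (hx : x ∈ S) :
    GSDichotomy S x ↔ ∀ k ∈ S, newSum S J 1 x ∣ newSum S J k x := by
  have hx0 := hS.1 x hx
  constructor
  · intro h k hk
    rcases h _ (hS.2 k hk x hx) (Nat.gcd_dvd_right k x) with ⟨y, hy, hky⟩ | hall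
    · simp [newSum, newDivisors_eq_empty hy hky]
    · rw [newSum_eq_pow_mul hJ hS (hS.1 k hk) hx]
      refine Dvd.intro_left _ (congrArg _ ?_)
      rw [newSum, newSum, newDivisors_eq_of_forall_dvd hS hx (Nat.gcd_dvd_right k x) hall]
  · intro h g hg hgx
    have hJd {k d : ℕ} (hd : d ∈ newDivisors S k x) : (0 : ℤ) < J d := by
      have := (mem_newDivisors.1 hd).1
      exact_mod_cast hpos d (Nat.pos_of_dvd_of_pos this.1 (Nat.pos_of_ne_zero this.2))
    have hsub := newDivisors_subset_of_dvd (S := S) hgx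
    rcases (newDivisors S g x).eq_empty_or_nonempty with hempty | hne
    · left
      have hxn : x ∉ newDivisors S g x := by simp [hempty]
      rw [mem_newDivisors, Nat.lcm_eq_right hgx] at hxn
      push Not at hxn
      obtain ⟨s, hs, hsx, hdvd⟩ := hxn ⟨dvd_rfl, hx0.ne'⟩
      have hlt : s.gcd x < x := (Nat.gcd_le_left x (hS.1 s hs)).trans_lt hsx
      obtain ⟨y, hy, hsy⟩ := exists_mem_GS_of_dvd hx0 (hS.2 s hs x hx)
        (Nat.gcd_dvd_right s x) hlt.ne
      refine ⟨y, hy, Nat.dvd_antisymm (Nat.lcm_dvd hgx (mem_GS.1 hy).2.1) ?_⟩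
      exact (dvd_lcm_gcd hdvd (Nat.dvd_lcm_right _ _)).trans (lcm_dvd_lcm_of_dvd dvd_rfl hsy)
    · right
      intro y hy
      obtain ⟨hyS, hyx, hy_lt, hymax⟩ := mem_GS.1 hy
      have heq : newDivisors S g x = newDivisors S 1 x := by
        by_contra hneq
        obtain ⟨d, hd, hdg⟩ := Finset.exists_of_ssubset (hsub.ssubset_of_ne hneq)
        have hlt : newSum S J g x < newSum S J 1 x :=
          Finset.sum_lt_sum_of_subset hsub hd hdg (hJd hd) fun i hi _ => (hJd hi).le
        exact hlt.not_ge (Int.le_of_dvd (Finset.sum_pos (fun i hi => hJd hi) hne) (h g hg))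
      have hn : g.lcm y ∉ newDivisors S 1 x := fun hn => by
        rw [← heq, mem_newDivisors] at hn
        exact hn.2 y hyS hy_lt dvd_rfl
      rw [mem_newDivisors] at hn
      simp only [Nat.lcm_one_left] at hn
      push Not at hn
      obtain ⟨s, hs, hsx, hdvd⟩ := hn ⟨Nat.lcm_dvd hgx hyx, hx0.ne'⟩
      have hdvd' := Nat.dvd_gcd hdvd (Nat.lcm_dvd hgx hyx)
      have hlt : s.gcd x < x := (Nat.gcd_le_left x (hS.1 s hs)).trans_lt hsx
      rcases hymax _ (hS.2 s hs x hx) ((Nat.dvd_lcm_right _ _).trans hdvd')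
        (Nat.gcd_dvd_right s x) with h' | h'
      · exact h' ▸ (Nat.dvd_lcm_left _ _).trans hdvd'
      · omega

/-- The divisibility incidence matrix of `x`. -/
def dvdMatrix {n : ℕ} (x : Fin n → ℕ) : Matrix (Fin n) (Fin n) ℤ :=
  Matrix.of fun i j => if x j ∣ x i then 1 else 0

lemma isUnit_dvdMatrix {n : ℕ} {x : Fin n → ℕ} (hinj : Function.Injective x)
    (hpos : ∀ i, 0 < x i) : IsUnit (dvdMatrix x) := by
  have htri : (dvdMatrix x).BlockTriangular (OrderDual.toDual ∘ x) := fun i j hij => by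
    have hlt : x i < x j := hij
    have : ¬ x j ∣ x i := fun h => absurd (Nat.le_of_dvd (hpos i) h) (by omega)
    simp [dvdMatrix, this]
  rw [Matrix.isUnit_iff_isUnit_det, htri.det]
  have hblock : ∀ a ∈ Finset.univ.image (OrderDual.toDual ∘ x),
      ((dvdMatrix x).toSquareBlock (OrderDual.toDual ∘ x) a).det = 1 := by
    intro a _
    have : (dvdMatrix x).toSquareBlock (OrderDual.toDual ∘ x) a = 1 := by
      ext ⟨i, hi⟩ ⟨j, hj⟩
      have hij : i = j := hinj (OrderDual.toDual.injective (hi.trans hj.symm))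
      subst hij
      simp [Matrix.toSquareBlock_def, dvdMatrix]
    rw [this, Matrix.det_one]
  rw [Finset.prod_congr rfl hblock]
  simp

lemma exists_mul_gcd_eq_lcm_iff {n : ℕ} {x : Fin n → ℕ} {J : ℕ → ℕ}
    (hJ : ∀ n, 0 < n → ∑ d ∈ n.divisors, J d = n ^ e)
    (hS : IsGcdClosed (Finset.univ.image x)) (hinj : Function.Injective x) :
    (∃ M : Matrix (Fin n) (Fin n) ℤ,
      (Matrix.of fun i j : Fin n => ((x i).lcm (x j) : ℤ) ^ e) =
        M * Matrix.of fun i j : Fin n => ((x i).gcd (x j) : ℤ) ^ e) ↔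
      ∀ k m, newSum (Finset.univ.image x) J 1 (x m) ∣
        newSum (Finset.univ.image x) J (x k) (x m) := by
  set S := Finset.univ.image x with hSdef
  have hmem : ∀ i, x i ∈ S := fun i => by simp [hSdef]
  have hpos : ∀ i, 0 < x i := fun i => hS.1 _ (hmem i)
  have hsum (f : ℕ → ℤ) (r : ℕ) :
      ∑ m ∈ S.filter (· ∣ r), f m = ∑ m, if x m ∣ r then f (x m) else 0 := by
    rw [Finset.sum_filter, hSdef, Finset.sum_image fun a _ b _ h => hinj h]
  set E := dvdMatrix x
  have hE : IsUnit E := isUnit_dvdMatrix hinj hpos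
  have hEt : IsUnit E.transpose := (Matrix.isUnit_transpose E).2 hE
  set N : Matrix (Fin n) (Fin n) ℤ := Matrix.of fun k m => newSum S J (x k) (x m) with hN
  set D : Matrix (Fin n) (Fin n) ℤ := Matrix.diagonal fun m => newSum S J 1 (x m) with hD
  have hlcm : (Matrix.of fun i j : Fin n => ((x i).lcm (x j) : ℤ) ^ e) = N * E.transpose := by
    ext k i
    simp only [Matrix.of_apply, ← sum_newSum hJ hS (hpos k) (hmem i), hsum, Matrix.mul_apply,
      Matrix.transpose_apply, hN, E, dvdMatrix, mul_ite, mul_one, mul_zero]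
  have hgcd : (Matrix.of fun i j : Fin n => ((x i).gcd (x j) : ℤ) ^ e) =
      E * D * E.transpose := by
    ext k i
    have := sum_newSum hJ hS one_pos (hS.2 _ (hmem k) _ (hmem i))
    rw [Nat.lcm_one_left] at this
    rw [Matrix.of_apply, ← this, hsum, Matrix.mul_apply]
    refine Finset.sum_congr rfl fun m _ => ?_
    simp only [Nat.dvd_gcd_iff, hD, Matrix.mul_diagonal, Matrix.transpose_apply, E, dvdMatrix,
      Matrix.of_apply]
    split_ifs <;> simp_all
  rw [hlcm, hgcd]
  constructor
  · rintro ⟨M, hM⟩ k m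
    have hND : N = M * E * D := hEt.mul_right_cancel (by simpa only [Matrix.mul_assoc] using hM)
    have := congrFun (congrFun hND k) m
    rw [hD, Matrix.mul_diagonal] at this
    exact Dvd.intro_left _ this.symm
  · intro h
    choose P hP using h
    obtain ⟨u, hu⟩ := hE
    have hND : N = Matrix.of P * D := by
      ext k m
      rw [hD, Matrix.mul_diagonal, hN, Matrix.of_apply, Matrix.of_apply, hP k m, mul_comm]
    refine ⟨Matrix.of P * (u⁻¹ : (Matrix (Fin n) (Fin n) ℤ)ˣ), ?_⟩
    rw [hND, ← hu]
    simp only [mul_assoc, Units.inv_mul_cancel_left]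

end

theorem power_gcd_dvd_power_lcm_iff_condC (n e : ℕ) (he : 0 < e) (x : Fin n → ℕ)
    (hinj : Function.Injective x) (hpos : ∀ i, 0 < x i)
    (hgcd : ∀ i j : Fin n, ∃ t, x t = Nat.gcd (x i) (x j))
    (hmax : ∃ i, 4 ≤ (GS (Finset.univ.image x) (x i)).card) :
    (∃ M : Matrix (Fin n) (Fin n) ℤ,
        (Matrix.of fun i j : Fin n => ((Nat.lcm (x i) (x j) : ℕ) : ℚ) ^ e) =
          M.map (fun z => (z : ℚ)) *
            (Matrix.of fun i j : Fin n => ((Nat.gcd (x i) (x j) : ℕ) : ℚ) ^ e)) ↔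
      condCSet (Finset.univ.image x) := by
  obtain ⟨J, hJ, hJpos⟩ := exists_pos_sum_divisors_eq_pow he
  have hS : IsGcdClosed (Finset.univ.image x) := by
    constructor
    · simpa using hpos
    · simpa [eq_comm] using fun i j => hgcd i j
  have hcast (M : Matrix (Fin n) (Fin n) ℤ) :
      (Matrix.of fun i j : Fin n => ((Nat.lcm (x i) (x j) : ℕ) : ℚ) ^ e) =
          M.map (fun z => (z : ℚ)) *
            (Matrix.of fun i j : Fin n => ((Nat.gcd (x i) (x j) : ℕ) : ℚ) ^ e) ↔
      (Matrix.of fun i j : Fin n => ((x i).lcm (x j) : ℤ) ^ e) =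
        M * Matrix.of fun i j : Fin n => ((x i).gcd (x j) : ℤ) ^ e := by
    simp only [← Matrix.ext_iff, Matrix.mul_apply, Matrix.map_apply, Matrix.of_apply]
    refine forall₂_congr fun i j => ?_
    exact_mod_cast Iff.rfl
  simp only [hcast]
  rw [exists_mul_gcd_eq_lcm_iff hJ hS hinj, condCSet_iff_forall_GSDichotomy hS]
  constructor
  · intro h y hy
    rw [GSDichotomy_iff_newSum_dvd hJ hJpos hS hy]
    simp only [Finset.mem_image, Finset.mem_univ, true_and] at hy ⊢
    obtain ⟨m, rfl⟩ := hy
    rintro _ ⟨k, rfl⟩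
    exact h k m
  · intro h k m
    have hmem (i : Fin n) : x i ∈ Finset.univ.image x := by simp
    exact (GSDichotomy_iff_newSum_dvd hJ hJpos hS (hmem m)).1 (h _ (hmem m)) _ (hmem k)
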